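/- For a job k ∈ B2 write x_{k2} = ⌊x_{k2}⌋ + ε_k, β_k = ⌊β_k⌋ + λ_k and α_k = ⌊α_k⌋ + ω_k with 0 ≤ λ_k, ω_k < 1 and 0 < ε_k < 1, where α_k = Σ_{h∈G1} y_{kh} and β_k = Σ_{h∈G2} y_{kh}. Then λ_k = ε_k; moreover ω_k = ε − ε_k if ε ≥ ε_k, and ω_k = 1 − (ε_k − ε) if ε < ε_k. -/

import Mathlib

open Finset

noncomputable section

/-- Feasibility for system `S`. -/
def FeasibleS {J M : Type*} [Fintype J] [Fintype M]
    (G1 G2 : Finset M) (b : J → M → ℕ) (a1 a2 : J → ℕ)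
    (y : J → M → ℝ) (x1 x2 : J → ℝ) (r w : ℝ) : Prop :=
  (∀ h ∈ G1, ((∑ j, (b j h : ℝ)) - ((∑ j, (a2 j : ℝ)) - r) ≤ (∑ j, y j h)) ∧
    ((∑ j, y j h) ≤ w)) ∧
  (∀ h ∈ G2, ((∑ j, (b j h : ℝ)) - ((∑ j, (a1 j : ℝ)) - r) ≤ (∑ j, y j h)) ∧
    ((∑ j, y j h) ≤ w)) ∧
  (∀ j, (∑ h, y j h) ≤ w) ∧
  (∀ j, ∀ h, 0 ≤ y j h ∧ y j h ≤ (b j h : ℝ)) ∧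
  ((∑ j, x1 j) = r) ∧ ((∑ j, x2 j) = r) ∧
  (∀ j, x1 j + x2 j ≤ r) ∧
  (∀ j, 0 ≤ x1 j ∧ x1 j ≤ (a1 j : ℝ)) ∧
  (∀ j, 0 ≤ x2 j ∧ x2 j ≤ (a2 j : ℝ)) ∧
  (∀ j, (∑ h ∈ G1, ((b j h : ℝ) - y j h)) + (a2 j : ℝ) - x2 j ≤ (∑ j', (a2 j' : ℝ)) - r) ∧
  (∀ j, (∑ h ∈ G2, ((b j h : ℝ) - y j h)) + (a1 j : ℝ) - x1 j ≤ (∑ j', (a1 j' : ℝ)) - r)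

/-- Feasibility for the linear program `ℓp` associated with an optimal
LP-relaxation value `(rstar, wstar)`. -/
def FeasibleLP {J M : Type*} [Fintype J] [Fintype M]
    (G1 G2 : Finset M) (b : J → M → ℕ) (a1 a2 : J → ℕ)
    (rstar wstar : ℝ)
    (y : J → M → ℝ) (x1 x2 : J → ℝ) (r w : ℝ) : Prop :=
  FeasibleS G1 G2 b a1 a2 y x1 x2 r w ∧
  w - r = (⌈wstar - rstar⌉ : ℝ) ∧ ((⌊rstar⌋ : ℝ) ≤ r)

/-- A doubly stochastic matrix has a permutation in its support through any positive entry. -/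
theorem perm_through_entry {N : Type*} [Fintype N] [DecidableEq N] (A : Matrix N N ℝ)
    (hA : A ∈ doublyStochastic ℝ N) (i0 j0 : N) (h0 : 0 < A i0 j0) :
    ∃ σ : Equiv.Perm N, σ i0 = j0 ∧ ∀ i, 0 < A i (σ i) := by
  obtain ⟨c, hc0, -, hc⟩ := exists_eq_sum_perm_of_mem_doublyStochastic hA
  have key : ∀ i j, A i j = ∑ σ : Equiv.Perm N, (if σ i = j then c σ else 0) := by
    intro i j
    rw [← hc]
    simp [Matrix.sum_apply, Equiv.toPEquiv_apply, PEquiv.toMatrix_apply]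
  have hpos : 0 < ∑ σ : Equiv.Perm N, (if σ i0 = j0 then c σ else 0) := by rw [← key]; exact h0
  obtain ⟨σ, -, hσ⟩ := Finset.exists_lt_of_sum_lt (s := Finset.univ)
    (f := fun _ : Equiv.Perm N => (0 : ℝ)) (by simpa using hpos)
  have h1 : σ i0 = j0 := by
    by_contra hne
    simp [hne] at hσ
  refine ⟨σ, h1, fun i => ?_⟩
  rw [if_pos h1] at hσ
  rw [key]
  refine lt_of_lt_of_le hσ ?_
  have := Finset.single_le_sum (s := Finset.univ)
    (f := fun τ : Equiv.Perm N => if τ i = σ i then c τ else 0)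
    (fun τ _ => by split_ifs <;> simp [hc0]) (Finset.mem_univ σ)
  simpa using this

/-- A unit time slice of the `w`-block that keeps job `j` away from the machines in `H`. -/
theorem exists_slice {J M : Type*} [Fintype J] [Fintype M] [DecidableEq J] [DecidableEq M]
    (y : J → M → ℝ) (w : ℝ) (hw : 0 < w) (hy : ∀ j h, 0 ≤ y j h)
    (hcol : ∀ h, ∑ j, y j h = w) (hrow : ∀ j, ∑ h, y j h ≤ w)
    (H : Finset M) (j : J) (hH : ∑ h ∈ H, y j h < w) :
    ∃ g : M → J, Function.Injective g ∧ (∀ h, 0 < y (g h) h) ∧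
      (∀ i, ∑ h, y i h = w → ∃ h, g h = i) ∧ ∀ h ∈ H, g h ≠ j := by
  let A : Matrix (J ⊕ M) (J ⊕ M) ℝ := Matrix.of fun p q =>
    match p, q with
    | Sum.inl i, Sum.inl i' => if i = i' then 1 - (∑ h, y i h) / w else 0
    | Sum.inl i, Sum.inr h => y i h / w
    | Sum.inr h, Sum.inl i => y i h / w
    | Sum.inr _, Sum.inr _ => 0
  have hrow' : ∀ i, (∑ h, y i h) / w ≤ 1 := fun i => (div_le_one hw).2 (hrow i)
  have hA : A ∈ doublyStochastic ℝ (J ⊕ M) := by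
    rw [mem_doublyStochastic_iff_sum]
    refine ⟨?_, ?_, ?_⟩
    · rintro (i | h) (i' | h')
      · simp only [A, Matrix.of_apply]
        split_ifs
        · linarith [hrow' i]
        · exact le_rfl
      · exact div_nonneg (hy _ _) hw.le
      · exact div_nonneg (hy _ _) hw.le
      · exact le_rfl
    · rintro (i | h)
      · simp [A, ← Finset.sum_div]
      · simp [A, ← Finset.sum_div, hcol, hw.ne']
    · rintro (i | h)
      · simp [A, ← Finset.sum_div]
      · simp [A, ← Finset.sum_div, hcol, hw.ne']
  have hent : ∃ q, 0 < A (Sum.inl j) q ∧ ∀ h ∈ H, q ≠ Sum.inr h := by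
    by_cases hj : ∑ h, y j h < w
    · refine ⟨Sum.inl j, ?_, by simp⟩
      have := (div_lt_one hw).2 hj
      simp only [A, Matrix.of_apply, if_true]
      linarith
    · by_contra hcon
      push Not at hcon
      have hz : ∀ h, h ∉ H → y j h = 0 := by
        intro h hh
        by_contra hne
        have hp : 0 < y j h := lt_of_le_of_ne (hy j h) (Ne.symm hne)
        obtain ⟨h', hh', he⟩ := hcon (Sum.inr h) (div_pos hp hw)
        exact hh ((Sum.inr.inj he) ▸ hh')
      have : ∑ h ∈ H, y j h = ∑ h, y j h :=
        Finset.sum_subset (Finset.subset_univ _) (fun h _ hh => hz h hh)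
      linarith
  obtain ⟨q, hq0, hqH⟩ := hent
  obtain ⟨σ, hσj, hσ⟩ := perm_through_entry A hA _ q hq0
  have hg : ∀ h, ∃ i, σ (Sum.inl i) = Sum.inr h := by
    intro h
    obtain ⟨p, hp⟩ := σ.surjective (Sum.inr h)
    rcases p with i | h'
    · exact ⟨i, hp⟩
    · have := hσ (Sum.inr h')
      rw [hp] at this
      simp [A] at this
  choose g hg using hg
  refine ⟨g, ?_, ?_, ?_, ?_⟩
  · intro h h' he
    have h1 := hg h
    rw [he, hg h'] at h1
    exact (Sum.inr.inj h1).symm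
  · intro h
    have h1 := hσ (Sum.inl (g h))
    rw [hg h] at h1
    have h2 : 0 < y (g h) h / w := h1
    exact (div_pos_iff_of_pos_right hw).1 h2
  · intro i hi
    have h1 := hσ (Sum.inl i)
    rcases hc : σ (Sum.inl i) with i' | h
    · rw [hc] at h1
      simp only [A, Matrix.of_apply] at h1
      rw [hi, div_self hw.ne'] at h1
      simp at h1
    · refine ⟨h, ?_⟩
      have := (hg h).trans hc.symm
      exact Sum.inl.inj (σ.injective this)
  · intro h hh he
    have h1 := hg h
    rw [he, hσj] at h1
    exact hqH h hh h1

/-- Basis exchange for the transversal structure on `G`: `g'` can be modified on `G` so that it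
misses `k` and still covers everything it covered besides `k`. -/
theorem exchange {J M : Type*} [DecidableEq M] (G : Finset M) (P : J → M → Prop)
    (g g' : M → J) (hgi : Function.Injective g) (hgi' : Function.Injective g')
    (hP : ∀ h, P (g h) h) (hP' : ∀ h, P (g' h) h) (k : J) (hk : ∀ h ∈ G, g h ≠ k) :
    ∃ f : M → J, (∀ h, P (f h) h) ∧ Set.InjOn f G ∧ (∀ h, h ∉ G → f h = g' h) ∧
      (∀ h ∈ G, f h ≠ k) ∧ ∀ i, i ≠ k → (∃ h, g' h = i) → ∃ h, f h = i := by
  classical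
  let R : M → M → Prop := fun h h' => h' ∈ G ∧ g' h' = g h
  let Q : M → Prop := fun h => ∃ h1 ∈ G, g' h1 = k ∧ Relation.ReflTransGen R h1 h
  have hQG : ∀ h, Q h → h ∈ G := by
    rintro h ⟨h1, hh1, -, hr⟩
    cases hr with
    | refl => exact hh1
    | tail _ hr => exact hr.1
  have hstep : ∀ h h', Q h → R h h' → Q h' := by
    rintro h h' ⟨h1, a, b, c⟩ hr
    exact ⟨h1, a, b, c.tail hr⟩
  refine ⟨fun h => if Q h then g h else g' h, ?_, ?_, ?_, ?_, ?_⟩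
  · intro h
    dsimp only
    split_ifs
    · exact hP h
    · exact hP' h
  · intro a ha b hb hab
    dsimp only at hab
    split_ifs at hab with h1 h2 h2
    · exact hgi hab
    · exact absurd (hstep a b h1 ⟨hb, hab.symm⟩) h2
    · exact absurd (hstep b a h2 ⟨ha, hab⟩) h1
    · exact hgi' hab
  · intro h hh
    exact if_neg (fun hq => hh (hQG h hq))
  · intro h hh
    dsimp only
    split_ifs with hq
    · exact hk h hh
    · intro he
      exact hq ⟨h, hh, he, Relation.ReflTransGen.refl⟩
  · rintro i hik ⟨h, rfl⟩
    by_cases hq : Q h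
    · obtain ⟨h1, a, b, c⟩ := hq
      cases c with
      | refl => exact absurd b hik
      | @tail h0 _ c hr =>
        exact ⟨h0, (if_pos (show Q h0 from ⟨h1, a, b, c⟩)).trans hr.2.symm⟩
    · exact ⟨h, if_neg hq⟩

/-- A positive step below all positive members of a finite family. -/
theorem exists_step {I : Type*} [Finite I] (c : I → ℝ) :
    ∃ δ : ℝ, 0 < δ ∧ ∀ i, 0 < c i → δ ≤ c i := by
  have : ∀ᶠ δ in nhdsWithin (0 : ℝ) (Set.Ioi 0), ∀ i, 0 < c i → δ ≤ c i := by
    rw [Filter.eventually_all]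
    intro i
    by_cases h : 0 < c i
    · filter_upwards [Ioo_mem_nhdsGT h] with δ hδ _ using hδ.2.le
    · exact Filter.Eventually.of_forall fun δ h' => absurd h' h
  obtain ⟨δ, h1, h2⟩ := (this.and self_mem_nhdsWithin).exists
  exact ⟨δ, h2, h1⟩

/-- The indicator sum of an injective slice over a group. -/
theorem slice_sum_le {J M : Type*} [DecidableEq J] (G : Finset M) (g : M → J)
    (hg : Set.InjOn g G) (j : J) : ∑ h ∈ G, (if g h = j then (1 : ℝ) else 0) ≤ 1 := by
  rw [Finset.sum_boole]
  have : (G.filter fun h => g h = j).card ≤ 1 := by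
    rw [Finset.card_le_one]
    intro a ha b hb
    simp only [Finset.mem_filter] at ha hb
    exact hg ha.1 hb.1 (ha.2.trans hb.2.symm)
  exact_mod_cast this

/-- A slice that can be removed contradicts the optimality of `r`. -/
theorem no_slice
    {J M : Type*} [Fintype J] [Fintype M] [DecidableEq J] [DecidableEq M]
    (G1 G2 : Finset M)
    (hdisj : Disjoint G1 G2) (hcover : G1 ∪ G2 = Finset.univ)
    (b : J → M → ℕ) (a1 a2 : J → ℕ) (rstar wstar : ℝ)
    (y : J → M → ℝ) (x1 x2 : J → ℝ) (r w : ℝ)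
    (hfeas : FeasibleLP G1 G2 b a1 a2 rstar wstar y x1 x2 r w)
    (hopt : ∀ y' x1' x2' r' w',
      FeasibleLP G1 G2 b a1 a2 rstar wstar y' x1' x2' r' w' → r ≤ r')
    (ε : ℝ) (hε0 : 0 < ε) (hrε : r = (⌊rstar⌋ : ℝ) + ε)
    (hsat1 : ∀ h ∈ G1, ((∑ j, y j h) = w) ∧
      (w = (∑ j, (b j h : ℝ)) - ((∑ j, (a2 j : ℝ)) - r)))
    (hsat2 : ∀ h ∈ G2, ((∑ j, y j h) = w) ∧
      (w = (∑ j, (b j h : ℝ)) - ((∑ j, (a1 j : ℝ)) - r)))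
    (g : M → J) (hg1 : Set.InjOn g G1) (hg2 : Set.InjOn g G2)
    (hgp : ∀ h, 0 < y (g h) h) (hgU : ∀ i, ∑ h, y i h = w → ∃ h, g h = i)
    (j1 j2 : J) (hj1 : 0 < x1 j1) (hj2 : 0 < x2 j2)
    (hT : ∀ i, x1 i + x2 i = r → i = j1 ∨ i = j2)
    (hS : (∑ h ∈ G2, ((b j1 h : ℝ) - y j1 h)) + (a1 j1 : ℝ) - x1 j1
        < (∑ j', (a1 j' : ℝ)) - r ∨ ∀ h ∈ G2, g h ≠ j1)
    (hV : (∑ h ∈ G1, ((b j2 h : ℝ) - y j2 h)) + (a2 j2 : ℝ) - x2 j2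
        < (∑ j', (a2 j' : ℝ)) - r ∨ ∀ h ∈ G1, g h ≠ j2) : False := by
  obtain ⟨⟨f1, f2, fU, fy, fx1, fx2, fT, fa1, fa2, fV, fS⟩, fw, fr⟩ := hfeas
  obtain ⟨dy, dy0, dy1⟩ := exists_step (fun p : J × M => y p.1 p.2)
  obtain ⟨dU, dU0, dU1⟩ := exists_step (fun i : J => w - ∑ h, y i h)
  obtain ⟨dT, dT0, dT1⟩ := exists_step (fun i : J => r - (x1 i + x2 i))
  obtain ⟨dV, dV0, dV1⟩ := exists_step (fun i : J => (∑ j', (a2 j' : ℝ)) - r -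
    ((∑ h ∈ G1, ((b i h : ℝ) - y i h)) + (a2 i : ℝ) - x2 i))
  obtain ⟨dS, dS0, dS1⟩ := exists_step (fun i : J => (∑ j', (a1 j' : ℝ)) - r -
    ((∑ h ∈ G2, ((b i h : ℝ) - y i h)) + (a1 i : ℝ) - x1 i))
  obtain ⟨δ, hδ0, hδ⟩ := exists_step (![dy, dU, dT, dV, dS, x1 j1, x2 j2, ε])
  have e1 : δ ≤ dy := hδ 0 dy0
  have e2 : δ ≤ dU := hδ 1 dU0
  have e3 : δ ≤ dT := hδ 2 dT0
  have e4 : δ ≤ dV := hδ 3 dV0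
  have e5 : δ ≤ dS := hδ 4 dS0
  have e6 : δ ≤ x1 j1 := hδ 5 hj1
  have e7 : δ ≤ x2 j2 := hδ 6 hj2
  have e8 : δ ≤ ε := hδ 7 hε0
  clear hδ
  let D : J → M → ℝ := fun j h => if g h = j then 1 else 0
  have D0 : ∀ j h, 0 ≤ D j h := fun j h => by simp only [D]; split_ifs <;> norm_num
  have Dcol : ∀ h, ∑ j, D j h = 1 := fun h => by simp [D]
  have D1 : ∀ j, ∑ h ∈ G1, D j h ≤ 1 := fun j => slice_sum_le G1 g hg1 j
  have D2 : ∀ j, ∑ h ∈ G2, D j h ≤ 1 := fun j => slice_sum_le G2 g hg2 j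
  have D10 : ∀ j, 0 ≤ ∑ h ∈ G1, D j h := fun j => Finset.sum_nonneg fun h _ => D0 j h
  have D20 : ∀ j, 0 ≤ ∑ h ∈ G2, D j h := fun j => Finset.sum_nonneg fun h _ => D0 j h
  have DU0 : ∀ j, 0 ≤ ∑ h, D j h := fun j => Finset.sum_nonneg fun h _ => D0 j h
  have DU : ∀ j, ∑ h, y j h = w → 1 ≤ ∑ h, D j h := by
    intro j hj
    obtain ⟨h, hh⟩ := hgU j hj
    have := Finset.single_le_sum (s := Finset.univ) (f := fun h => D j h)
      (fun h _ => D0 j h) (Finset.mem_univ h)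
    simpa [D, hh] using this
  have scol : ∀ h, ∑ j, (y j h - δ * D j h) = (∑ j, y j h) - δ := by
    intro h
    rw [Finset.sum_sub_distrib, ← Finset.mul_sum, Dcol, mul_one]
  have srow : ∀ j, ∑ h, (y j h - δ * D j h) = (∑ h, y j h) - δ * ∑ h, D j h := by
    intro j
    rw [Finset.sum_sub_distrib, ← Finset.mul_sum]
  have sg : ∀ (G : Finset M) j, ∑ h ∈ G, ((b j h : ℝ) - (y j h - δ * D j h)) =
      ∑ h ∈ G, ((b j h : ℝ) - y j h) + δ * ∑ h ∈ G, D j h := by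
    intro G j
    rw [Finset.mul_sum, ← Finset.sum_add_distrib]
    exact Finset.sum_congr rfl fun h _ => by ring
  have hmain := hopt (fun j h => y j h - δ * D j h)
    (fun j => x1 j - δ * if j = j1 then 1 else 0) (fun j => x2 j - δ * if j = j2 then 1 else 0)
    (r - δ) (w - δ) ?_
  · linarith
  refine ⟨⟨?_, ?_, ?_, ?_, ?_, ?_, ?_, ?_, ?_, ?_, ?_⟩, ?_, ?_⟩
  · intro h hh
    rw [scol]
    obtain ⟨u, v⟩ := hsat1 h hh
    constructor <;> linarith
  · intro h hh
    rw [scol]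
    obtain ⟨u, v⟩ := hsat2 h hh
    constructor <;> linarith
  · intro j
    rw [srow]
    rcases (fU j).eq_or_lt with h | h
    · nlinarith [DU j h]
    · have h3 : dU ≤ w - ∑ h, y j h := dU1 j (by linarith)
      nlinarith [DU0 j]
  · intro j h
    constructor
    · by_cases hh : g h = j
      · subst hh
        have h3 : dy ≤ y (g h) h := dy1 (g h, h) (hgp h)
        simp only [D, if_true]
        linarith
      · simp only [D, if_neg hh]
        linarith [(fy j h).1]
    · nlinarith [(fy j h).2, D0 j h]
  · rw [Finset.sum_sub_distrib, ← Finset.mul_sum, fx1]; simp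
  · rw [Finset.sum_sub_distrib, ← Finset.mul_sum, fx2]; simp
  · intro j
    have n1 : (0 : ℝ) ≤ if j = j1 then 1 else 0 := by split_ifs <;> norm_num
    have n2 : (0 : ℝ) ≤ if j = j2 then 1 else 0 := by split_ifs <;> norm_num
    rcases (fT j).eq_or_lt with h | h
    · have : (1 : ℝ) ≤ (if j = j1 then 1 else 0) + (if j = j2 then 1 else 0) := by
        rcases hT j h with h | h
        · rw [if_pos h]; linarith
        · rw [if_pos h]; linarith
      nlinarith
    · have h3 : dT ≤ r - (x1 j + x2 j) := dT1 j (by linarith)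
      nlinarith
  · intro j
    by_cases h : j = j1
    · subst h
      simp only [if_true]
      constructor <;> linarith [(fa1 j).1, (fa1 j).2]
    · simp only [if_neg h]
      constructor <;> linarith [(fa1 j).1, (fa1 j).2]
  · intro j
    by_cases h : j = j2
    · subst h
      simp only [if_true]
      constructor <;> linarith [(fa2 j).1, (fa2 j).2]
    · simp only [if_neg h]
      constructor <;> linarith [(fa2 j).1, (fa2 j).2]
  · intro j
    rw [sg]
    have hb : δ * ∑ h ∈ G1, D j h ≤ δ := by nlinarith [D1 j]
    by_cases h : j = j2
    · subst h
      simp only [if_true]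
      rcases hV with h | h
      · have h3 := dV1 j (by linarith)
        linarith
      · have : ∑ h ∈ G1, D j h = 0 :=
          Finset.sum_eq_zero fun h' hh' => if_neg (h h' hh')
        rw [this]
        linarith [fV j]
    · simp only [if_neg h]
      linarith [fV j]
  · intro j
    rw [sg]
    have hb : δ * ∑ h ∈ G2, D j h ≤ δ := by nlinarith [D2 j]
    by_cases h : j = j1
    · subst h
      simp only [if_true]
      rcases hS with h | h
      · have h3 := dS1 j (by linarith)
        linarith
      · have : ∑ h ∈ G2, D j h = 0 :=
          Finset.sum_eq_zero fun h' hh' => if_neg (h h' hh')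
        rw [this]
        linarith [fS j]
    · simp only [if_neg h]
      linarith [fS j]
  · linarith
  · linarith

theorem fractional_parts_B2
    {J M : Type*} [Fintype J] [Fintype M] [DecidableEq J] [DecidableEq M]
    (G1 G2 : Finset M) (hG1ne : G1.Nonempty) (hG2ne : G2.Nonempty)
    (hdisj : Disjoint G1 G2) (hcover : G1 ∪ G2 = Finset.univ)
    (b : J → M → ℕ) (a1 a2 : J → ℕ)
    (ystar : J → M → ℝ) (x1star x2star : J → ℝ) (rstar wstar : ℝ)
    (hstar : FeasibleS G1 G2 b a1 a2 ystar x1star x2star rstar wstar)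
    (hstaropt : ∀ y' x1' x2' r' w', FeasibleS G1 G2 b a1 a2 y' x1' x2' r' w' →
      wstar - rstar ≤ w' - r')
    (y : J → M → ℝ) (x1 x2 : J → ℝ) (r w : ℝ)
    (hfeas : FeasibleLP G1 G2 b a1 a2 rstar wstar y x1 x2 r w)
    (hopt : ∀ y' x1' x2' r' w',
      FeasibleLP G1 G2 b a1 a2 rstar wstar y' x1' x2' r' w' → r ≤ r')
    (ε : ℝ) (hε0 : 0 < ε) (hε1 : ε < 1) (hrε : r = (⌊rstar⌋ : ℝ) + ε)
    (hsat1 : ∀ h ∈ G1, ((∑ j, y j h) = w) ∧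
      (w = (∑ j, (b j h : ℝ)) - ((∑ j, (a2 j : ℝ)) - r)))
    (hsat2 : ∀ h ∈ G2, ((∑ j, y j h) = w) ∧
      (w = (∑ j, (b j h : ℝ)) - ((∑ j, (a1 j : ℝ)) - r)))
    (B1 B2 : Finset J)
    (hB1 : ∀ j, j ∈ B1 ↔ ¬∃ z : ℤ, x1 j = (z : ℝ))
    (hB2 : ∀ j, j ∈ B2 ↔ ¬∃ z : ℤ, x2 j = (z : ℝ))
    (k : J) (hk : k ∈ B2)
    (εk lamk omgk : ℝ) (hek0 : 0 < εk) (hek1 : εk < 1)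
    (hlamk0 : 0 ≤ lamk) (hlamk1 : lamk < 1) (homgk0 : 0 ≤ omgk) (homgk1 : omgk < 1)
    (hx : x2 k = (⌊x2 k⌋ : ℝ) + εk)
    (hβ : (∑ h ∈ G2, y k h) = (⌊(∑ h ∈ G2, y k h)⌋ : ℝ) + lamk)
    (hα : (∑ h ∈ G1, y k h) = (⌊(∑ h ∈ G1, y k h)⌋ : ℝ) + omgk) :
    lamk = εk ∧ (εk ≤ ε → omgk = ε - εk) ∧ (ε < εk → omgk = 1 - (εk - ε)) := by

  have hfeas' := hfeas
  obtain ⟨⟨f1, f2, fU, fy, fx1, fx2, fT, fa1, fa2, fV, fS⟩, fw, fr⟩ := hfeas'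
  have hcolw : ∀ h, ∑ j, y j h = w := by
    intro h
    have : h ∈ G1 ∪ G2 := by rw [hcover]; exact Finset.mem_univ h
    rcases Finset.mem_union.1 this with h' | h'
    · exact (hsat1 h h').1
    · exact (hsat2 h h').1
  have hrow : ∀ j, ∑ h, y j h = ∑ h ∈ G1, y j h + ∑ h ∈ G2, y j h := by
    intro j
    rw [← Finset.sum_union hdisj, hcover]
  have hα0 : ∀ j, 0 ≤ ∑ h ∈ G1, y j h := fun j => Finset.sum_nonneg fun h _ => (fy j h).1
  have hβ0 : ∀ j, 0 ≤ ∑ h ∈ G2, y j h := fun j => Finset.sum_nonneg fun h _ => (fy j h).1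
  have hnotint : ∀ z : ℤ, ε ≠ (z : ℝ) := by
    intro z hz
    rw [hz] at hε0 hε1
    have h1 : 0 < z := by exact_mod_cast hε0
    have h2 : z < 1 := by exact_mod_cast hε1
    omega
  have hw0 : 0 < w := by
    obtain ⟨h, hh⟩ := hG1ne
    have h1 : 0 ≤ w := by
      rw [← hcolw h]
      exact Finset.sum_nonneg fun j _ => (fy j h).1
    refine lt_of_le_of_ne h1 fun h0 => hnotint (-⌈wstar - rstar⌉ - ⌊rstar⌋) ?_
    push_cast
    linarith
  have hr0 : 0 < r := by
    have h1 : 0 ≤ r := by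
      rw [← fx1]
      exact Finset.sum_nonneg fun j _ => (fa1 j).1
    refine lt_of_le_of_ne h1 fun h0 => hnotint (-⌊rstar⌋) ?_
    push_cast
    linarith
  have hx2k : 0 < x2 k := by
    refine lt_of_le_of_ne (fa2 k).1 fun h0 => (hB2 k).1 hk ⟨0, ?_⟩
    simp [← h0]
  -- a tight `S`-row with full load on `G2` has integral `x1`
  have hSint : ∀ j, (∑ h ∈ G2, ((b j h : ℝ) - y j h)) + (a1 j : ℝ) - x1 j
      = (∑ j', (a1 j' : ℝ)) - r → ∑ h ∈ G2, y j h = w → ∃ z : ℤ, x1 j = (z : ℝ) := by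
    intro j h1 h2
    refine ⟨(∑ h ∈ G2, (b j h : ℤ)) + a1 j - (∑ j', (a1 j' : ℤ)) - ⌈wstar - rstar⌉, ?_⟩
    rw [Finset.sum_sub_distrib, h2] at h1
    push_cast
    linarith
  obtain ⟨q, hq⟩ : ∃ q, ¬ ∃ z : ℤ, x1 q = (z : ℝ) := by
    by_contra hcon
    push Not at hcon
    choose z hz using hcon
    refine hnotint ((∑ j, z j) - ⌊rstar⌋) ?_
    push_cast
    rw [← Finset.sum_congr rfl fun j _ => hz j]
    linarith
  have hq0 : 0 < x1 q := by
    refine lt_of_le_of_ne (fa1 q).1 fun h0 => hq ⟨0, ?_⟩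
    simp [← h0]
  have hβle : ∀ j, ∑ h ∈ G2, y j h ≤ w := by
    intro j
    have := fU j
    rw [hrow] at this
    linarith [hα0 j]
  have good : ∀ j, (¬ ∃ z : ℤ, x1 j = (z : ℝ)) →
      (∑ h ∈ G2, ((b j h : ℝ) - y j h)) + (a1 j : ℝ) - x1 j < (∑ j', (a1 j' : ℝ)) - r ∨
      ∑ h ∈ G2, y j h < w := by
    intro j hj
    by_contra hcon
    push Not at hcon
    exact hj (hSint j (le_antisymm (fS j) hcon.1) (le_antisymm (hβle j) hcon.2))
  -- slices adapted to a `good` job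
  have slice : ∀ j, ((∑ h ∈ G2, ((b j h : ℝ) - y j h)) + (a1 j : ℝ) - x1 j
        < (∑ j', (a1 j' : ℝ)) - r ∨ ∑ h ∈ G2, y j h < w) →
      ∃ g : M → J, Function.Injective g ∧ (∀ h, 0 < y (g h) h) ∧
        (∀ i, ∑ h, y i h = w → ∃ h, g h = i) ∧
        ((∑ h ∈ G2, ((b j h : ℝ) - y j h)) + (a1 j : ℝ) - x1 j
        < (∑ j', (a1 j' : ℝ)) - r ∨ ∀ h ∈ G2, g h ≠ j) := by
    rintro j (hj | hj)
    · obtain ⟨g, p1, p2, p3, -⟩ := exists_slice y w hw0 (fun j h => (fy j h).1) hcolw fU ∅ j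
        (by simpa using hw0)
      exact ⟨g, p1, p2, p3, Or.inl hj⟩
    · obtain ⟨g, p1, p2, p3, p4⟩ := exists_slice y w hw0 (fun j h => (fy j h).1) hcolw fU G2 j hj
      exact ⟨g, p1, p2, p3, Or.inr p4⟩
  -- at most two jobs carry a tight `T`-row
  have three : ∀ p p' t, p ≠ p' → t ≠ p → t ≠ p' → x1 p + x2 p = r → x1 p' + x2 p' = r →
      x1 t + x2 t ≤ 0 := by
    intro p p' t h1 h2 h3 h4 h5
    have hs : ∑ j ∈ ({p, p', t} : Finset J), (x1 j + x2 j) ≤ ∑ j, (x1 j + x2 j) :=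
      Finset.sum_le_sum_of_subset_of_nonneg (Finset.subset_univ _)
        fun j _ _ => add_nonneg (fa1 j).1 (fa2 j).1
    rw [Finset.sum_add_distrib (s := Finset.univ), fx1, fx2,
      Finset.sum_insert (by simp [h1, h2.symm]), Finset.sum_insert (by simp [h3.symm]),
      Finset.sum_singleton] at hs
    linarith
  -- the partner job
  obtain ⟨j, hj0, hjT, hjg⟩ : ∃ j, 0 < x1 j ∧ (∀ i, x1 i + x2 i = r → i = j ∨ i = k) ∧
      ((∑ h ∈ G2, ((b j h : ℝ) - y j h)) + (a1 j : ℝ) - x1 j < (∑ j', (a1 j' : ℝ)) - r ∨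
      ∑ h ∈ G2, y j h < w) := by
    by_cases hp : ∃ p, p ≠ k ∧ x1 p + x2 p = r
    · obtain ⟨p, hpk, hpT⟩ := hp
      have hp0 : 0 < x1 p := by
        have hs : ∑ j ∈ ({p, k} : Finset J), x2 j ≤ ∑ j, x2 j :=
          Finset.sum_le_sum_of_subset_of_nonneg (Finset.subset_univ _) fun j _ _ => (fa2 j).1
        rw [fx2, Finset.sum_pair hpk] at hs
        linarith
      by_cases hpg : (∑ h ∈ G2, ((b p h : ℝ) - y p h)) + (a1 p : ℝ) - x1 p
          < (∑ j', (a1 j' : ℝ)) - r ∨ ∑ h ∈ G2, y p h < w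
      · refine ⟨p, hp0, ?_, hpg⟩
        intro i hi
        by_contra hcon
        push Not at hcon
        have := three p i k hcon.1.symm hpk.symm hcon.2.symm hpT hi
        linarith [(fa1 k).1]
      · exfalso
        push Not at hpg
        have hpβ := le_antisymm (hβle p) hpg.2
        obtain ⟨z, hz⟩ := hSint p (le_antisymm (fS p) hpg.1) hpβ
        have hpα : ∑ h ∈ G1, y p h = 0 := by
          have := fU p
          rw [hrow] at this
          linarith [hα0 p]
        have hp2 : 0 < x2 p := by
          refine lt_of_le_of_ne (fa2 p).1 fun h0 => hnotint (z - ⌊rstar⌋) ?_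
          push_cast
          linarith
        obtain ⟨g, p1, p2, p3, p4⟩ := slice q (good q hq)
        have hpq : q ≠ p := by
          rintro rfl
          exact hq ⟨z, hz⟩
        refine no_slice G1 G2 hdisj hcover b a1 a2 rstar wstar y x1 x2 r w hfeas hopt ε hε0 hrε
          hsat1 hsat2 g p1.injOn p1.injOn p2 p3 q p hq0 hp2 ?_ p4 (Or.inr ?_)
        · intro i hi
          by_contra hcon
          push Not at hcon
          have := three p i q hcon.2.symm hpq hcon.1.symm hpT hi
          linarith [(fa2 q).1]
        · intro h hh he
          have h1 := (Finset.sum_eq_zero_iff_of_nonneg fun h _ => (fy p h).1).1 hpα h hh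
          have h2 := p2 h
          rw [he, h1] at h2
          exact lt_irrefl _ h2
    · push Not at hp
      refine ⟨q, hq0, ?_, good q hq⟩
      intro i hi
      by_contra hcon
      push Not at hcon
      exact hp i hcon.2 hi
  obtain ⟨g', p1, p2, p3, p4⟩ := slice j hjg
  have hVt : (∑ h ∈ G1, ((b k h : ℝ) - y k h)) + (a2 k : ℝ) - x2 k
      = (∑ j', (a2 j' : ℝ)) - r := by
    by_contra hne
    exact no_slice G1 G2 hdisj hcover b a1 a2 rstar wstar y x1 x2 r w hfeas hopt ε hε0 hrε
      hsat1 hsat2 g' p1.injOn p1.injOn p2 p3 j k hj0 hx2k hjT p4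
      (Or.inl (lt_of_le_of_ne (fV k) hne))
  have hUt : ∑ h, y k h = w := by
    by_contra hne
    have hlt := lt_of_le_of_ne (fU k) hne
    have hαlt : ∑ h ∈ G1, y k h < w := by
      rw [hrow] at hlt
      linarith [hβ0 k]
    obtain ⟨g, s1, s2, s3, s4⟩ :=
      exists_slice y w hw0 (fun j h => (fy j h).1) hcolw fU G1 k hαlt
    obtain ⟨f, t1, t2, t3, t4, t5⟩ :=
      exchange G1 (fun j h => 0 < y j h) g g' s1 p1 s2 p2 k s4
    have hG2 : ∀ h ∈ G2, f h = g' h := fun h hh =>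
      t3 h (fun h1 => Finset.disjoint_left.1 hdisj h1 hh)
    refine no_slice G1 G2 hdisj hcover b a1 a2 rstar wstar y x1 x2 r w hfeas hopt ε hε0 hrε
      hsat1 hsat2 f t2 ?_ t1 ?_ j k hj0 hx2k hjT ?_ (Or.inr t4)
    · intro c hc d hd hcd
      rw [hG2 c hc, hG2 d hd] at hcd
      exact p1 hcd
    · intro i hi
      refine t5 i ?_ (p3 i hi)
      rintro rfl
      exact hne hi
    · rcases p4 with h | h
      · exact Or.inl h
      · refine Or.inr fun h' hh' => ?_
        rw [hG2 h' hh']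
        exact h h' hh'
  -- arithmetic
  rw [hrow] at hUt
  rw [Finset.sum_sub_distrib] at hVt
  obtain ⟨N, hN⟩ : ∃ N : ℤ, (N : ℝ) = (∑ h ∈ G1, (b k h : ℝ)) + a2 k - ∑ j', (a2 j' : ℝ) :=
    ⟨(∑ h ∈ G1, (b k h : ℤ)) + a2 k - ∑ j', (a2 j' : ℤ), by push_cast; rfl⟩
  have hz1 : lamk - εk = ((⌈wstar - rstar⌉ - N + ⌊x2 k⌋ - ⌊∑ h ∈ G2, y k h⌋ : ℤ) : ℝ) := by
    push_cast
    linarith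
  have hz2 : omgk - (ε - εk) = ((N + ⌊rstar⌋ - ⌊x2 k⌋ - ⌊∑ h ∈ G1, y k h⌋ : ℤ) : ℝ) := by
    push_cast
    linarith
  generalize (⌈wstar - rstar⌉ - N + ⌊x2 k⌋ - ⌊∑ h ∈ G2, y k h⌋ : ℤ) = z1 at hz1
  generalize (N + ⌊rstar⌋ - ⌊x2 k⌋ - ⌊∑ h ∈ G1, y k h⌋ : ℤ) = z2 at hz2
  have l1 : z1 < 1 := by
    have : (z1 : ℝ) < 1 := by linarith
    exact_mod_cast this
  have l2 : -1 < z1 := by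
    have : (-1 : ℝ) < z1 := by linarith
    exact_mod_cast this
  have l3 : z1 = 0 := by omega
  refine ⟨?_, ?_, ?_⟩
  · rw [l3] at hz1
    push_cast at hz1
    linarith
  · intro he
    have m1 : z2 < 1 := by
      have : (z2 : ℝ) < 1 := by linarith
      exact_mod_cast this
    have m2 : -1 < z2 := by
      have : (-1 : ℝ) < z2 := by linarith
      exact_mod_cast this
    have m3 : z2 = 0 := by omega
    rw [m3] at hz2
    push_cast at hz2
    linarith
  · intro he
    have m1 : z2 < 2 := by
      have : (z2 : ℝ) < 2 := by linarith
      exact_mod_cast this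
    have m2 : 0 < z2 := by
      have : (0 : ℝ) < z2 := by linarith
      exact_mod_cast this
    have m3 : z2 = 1 := by omega
    rw [m3] at hz2
    push_cast at hz2
    linarith
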